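/- Assume weak Vopěnka's principle in the form: in any presentable category K, there is no Ord-indexed family of objects (K_α) with Hom(K_α, K_β) empty for α < β and nonempty for α ≥ β. Then in a presentable category C, any full subcategory A closed under small products is weakly reflective: for every object X of C, the coslice category A_{X/} has a weakly initial set of objects. -/

import Mathlib

open CategoryTheory Limits

universe v

/-- A small category `J` is `κ`-filtered if every diagram of size `< κ` in `J`
admits a cocone. -/
def CardFiltered (J : Type v) [SmallCategory J] (κ : Cardinal.{v}) : Prop :=
  ∀ (K : Type v) [SmallCategory K] (F : K ⥤ J),
    Cardinal.mk (Σ a b : K, a ⟶ b) < κ → Nonempty (Cocone F)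

/-- An object `X` is `κ`-presentable if its hom-functor `Hom(X, -)` preserves
`κ`-filtered colimits. -/
def IsPresentableObj {C : Type (v + 1)} [Category.{v} C] (κ : Cardinal.{v})
    (X : C) : Prop :=
  ∀ (J : Type v) [SmallCategory J], CardFiltered J κ →
    Nonempty (PreservesColimitsOfShape J (coyoneda.obj (Opposite.op X)))

/-- A presentation of `X` as a `κ`-filtered colimit of objects from the family
`Gobj`. -/
structure FilteredColimitPresentation {C : Type (v + 1)} [Category.{v} C]
    (κ : Cardinal.{v}) {ι : Type v} (Gobj : ι → C) (X : C) where
  J : Type v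
  [instJ : SmallCategory J]
  filtered : CardFiltered J κ
  F : J ⥤ C
  factors : ∀ j : J, ∃ i : ι, Nonempty (F.obj j ≅ Gobj i)
  cocone : Cocone F
  isColimit : IsColimit cocone
  ptIso : cocone.pt ≅ X

/-- A category is locally presentable if it is cocomplete and, for some regular
cardinal `κ`, has a small family of `κ`-presentable objects of which every
object is a `κ`-filtered colimit. -/
def LocallyPresentable (C : Type (v + 1)) [Category.{v} C] : Prop :=
  HasColimits C ∧
    ∃ (κ : Cardinal.{v}), κ.IsRegular ∧
      ∃ (ι : Type v) (Gobj : ι → C),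
        (∀ i, IsPresentableObj κ (Gobj i)) ∧
        ∀ X : C, Nonempty (FilteredColimitPresentation κ Gobj X)

section Helpers

theorem cardFiltered_iff (J : Type v) [SmallCategory J] (κ : Cardinal.{v}) [Fact κ.IsRegular] :
    CardFiltered J κ ↔ IsCardinalFiltered J κ := by
  have key : ∀ (K : Type v) [SmallCategory K],
      HasCardinalLT (Arrow K) κ ↔ Cardinal.mk (Σ a b : K, a ⟶ b) < κ := by
    intro K _
    rw [← hasCardinalLT_iff_cardinal_mk_lt]
    apply hasCardinalLT_iff_of_equiv
    exact
      { toFun := fun f => ⟨f.left, f.right, f.hom⟩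
        invFun := fun f => Arrow.mk f.2.2
        left_inv := fun _ => rfl
        right_inv := fun _ => rfl }
  constructor
  · intro h
    exact ⟨fun {K} _ F hK => h K F ((key K).1 hK)⟩
  · intro h K _ F hK
    exact h.nonempty_cocone F ((key K).2 hK)

theorem isPresentableObj_iff {C : Type (v + 1)} [Category.{v} C] (κ : Cardinal.{v})
    [Fact κ.IsRegular] (X : C) : IsPresentableObj κ X ↔ IsCardinalPresentable X κ := by
  constructor
  · intro h
    exact ⟨fun J _ hJ => (h J ((cardFiltered_iff J κ).2 hJ)).some⟩
  · intro h J _ hJ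
    have := (cardFiltered_iff J κ).1 hJ
    exact ⟨(coyoneda.obj (Opposite.op X)).preservesColimitsOfShape_of_isCardinalAccessible κ J⟩

theorem locallyPresentable_iff (C : Type (v + 1)) [Category.{v} C] :
    LocallyPresentable C ↔ IsLocallyPresentable.{v} C := by
  constructor
  · rintro ⟨hcol, κ, hκ, ι, G, hG, hX⟩
    have : Fact κ.IsRegular := ⟨hκ⟩
    refine ⟨κ, this, ?_⟩
    have gen : (ObjectProperty.ofObj G).isoClosure.IsCardinalFilteredGenerator κ := by
      refine ⟨?_, ?_⟩
      · rw [ObjectProperty.isoClosure_le_iff]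
        rintro _ ⟨i⟩
        exact (isPresentableObj_iff κ _).1 (hG i)
      · intro X
        obtain ⟨p⟩ := hX X
        let := p.instJ
        refine ⟨p.J, p.instJ, (cardFiltered_iff _ κ).1 p.filtered, ?_⟩
        refine ObjectProperty.prop_of_iso _ p.ptIso ⟨{
          diag := p.F
          ι := p.cocone.ι
          isColimit := p.isColimit
          prop_diag_obj := fun j => ?_ }⟩
        obtain ⟨i, ⟨e⟩⟩ := p.factors j
        exact ⟨_, ObjectProperty.ofObj_apply G i, ⟨e⟩⟩
    have := (ObjectProperty.IsCardinalFilteredGenerator.isoClosure_iff.1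
      gen).hasCardinalFilteredGenerator
    constructor
  · intro h
    obtain ⟨κ, hκ, hC⟩ := IsLocallyPresentable.exists_cardinal.{v} C
    obtain ⟨P, hP, hgen⟩ := HasCardinalFilteredGenerator.exists_small_generator C κ
    refine ⟨hC.toHasColimitsOfSize, κ, hκ.out, Shrink.{v} (Subtype P),
      fun i => ((equivShrink (Subtype P)).symm i).1, ?_, ?_⟩
    · intro i
      exact (isPresentableObj_iff κ _).2
        (hgen.le_isCardinalPresentable _ ((equivShrink (Subtype P)).symm i).2)
    · intro X
      obtain ⟨J, _, hJ, ⟨p⟩⟩ := hgen.exists_colimitsOfShape X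
      exact ⟨{
        J := J
        filtered := (cardFiltered_iff J κ).2 hJ
        F := p.diag
        factors := fun j => ⟨equivShrink _ ⟨_, p.prop_diag_obj j⟩,
          ⟨eqToIso (by simp)⟩⟩
        cocone := p.cocone
        isColimit := p.isColimit
        ptIso := Iso.refl _ }⟩

theorem hasLimits_of_isLocallyPresentable (C : Type (v + 1)) [Category.{v} C]
    [IsLocallyPresentable.{v} C] : HasLimits C := by
  obtain ⟨κ, hκ, hC⟩ := IsLocallyPresentable.exists_cardinal.{v} C
  let S := SmallModel.{v} (isCardinalPresentable C κ).FullSubcategory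
  let F : S ⥤ C := (equivSmallModel.{v} _).inverse ⋙ (isCardinalPresentable C κ).ι
  let adj := Presheaf.uliftYonedaAdjunction.{v} (A := F)
    (uliftYoneda.{v}.leftKanExtension F) (uliftYoneda.{v}.leftKanExtensionUnit F)
  let : Reflective (Presheaf.restrictedULiftYoneda.{v} F) := ⟨_, adj⟩
  exact hasLimits_of_reflective (Presheaf.restrictedULiftYoneda.{v} F)

theorem under_isLocallyPresentable (C : Type (v + 1)) [Category.{v} C]
    [IsLocallyPresentable.{v} C] (X : C) : IsLocallyPresentable.{v} (Under X) := by
  obtain ⟨κ, hκ, hC⟩ := IsLocallyPresentable.exists_cardinal.{v} C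
  refine ⟨κ, hκ, ?_⟩
  have : HasColimitsOfSize.{v, v} C := hC.toHasColimitsOfSize
  obtain ⟨P, _, h₁, h₂⟩ :=
    (IsCardinalLocallyPresentable.iff_exists_isStrongGenerator C κ).1 inferInstance
  have acc : (Under.forget X).IsCardinalAccessible κ := ⟨fun J _ _ => by
    have := isFiltered_of_isCardinalFiltered J κ
    exact PreservesFilteredColimitsOfSize.preserves_filtered_colimits J⟩
  have adj := Under.costarAdjForget X
  rw [IsCardinalLocallyPresentable.iff_exists_isStrongGenerator]
  refine ⟨ObjectProperty.ofObj (fun T : Subtype P => (Under.costar X).obj T.1),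
    inferInstance, ?_, ?_⟩
  · rw [ObjectProperty.isStrongGenerator_iff] at h₁ ⊢
    obtain ⟨hs, hm⟩ := h₁
    refine ⟨?_, ?_⟩
    · intro Y Z f g h
      apply (Under.forget X).map_injective
      apply hs
      intro G hG t
      have := h _ (ObjectProperty.ofObj_apply (fun T : Subtype P => (Under.costar X).obj T.1)
        ⟨G, hG⟩) ((adj.homEquiv _ _).symm t)
      have h2 := congrArg (adj.homEquiv _ _) this
      rw [adj.homEquiv_naturality_right, adj.homEquiv_naturality_right,
        Equiv.apply_symm_apply] at h2
      exact h2
    · intro Y Z i _ hi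
      have : IsIso ((Under.forget X).map i) := by
        refine hm _ ?_
        intro G hG t
        obtain ⟨u, hu⟩ := hi _ (ObjectProperty.ofObj_apply
          (fun T : Subtype P => (Under.costar X).obj T.1) ⟨G, hG⟩) ((adj.homEquiv _ _).symm t)
        refine ⟨adj.homEquiv _ _ u, ?_⟩
        have h2 := congrArg (adj.homEquiv _ _) hu
        dsimp only at h2
        rw [adj.homEquiv_naturality_right, Equiv.apply_symm_apply] at h2
        exact h2
      exact isIso_of_reflects_iso i (Under.forget X)
  · rintro _ ⟨T⟩
    have : IsCardinalPresentable T.1 κ := h₂ _ T.2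
    exact adj.isCardinalPresentable_leftAdjoint_obj κ T.1

end Helpers

/-- Weak Vopěnka's principle: in a presentable category there is no
`Ord`-indexed family `(K_α)` with `Hom(K_α, K_β)` empty for `α < β` and
nonempty for `α ≥ β`. Under this assumption, any full subcategory `A` of a
presentable category `C` closed under small products is weakly reflective:
every coslice `A_{X/}` has a weakly initial set. -/
theorem stmt19
    (wvp : ∀ (K : Type (v + 1)) [Category.{v} K], LocallyPresentable K →
      ¬ ∃ f : Ordinal.{v} → K,
          (∀ a b : Ordinal.{v}, a < b → IsEmpty (f a ⟶ f b)) ∧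
          (∀ a b : Ordinal.{v}, b ≤ a → Nonempty (f a ⟶ f b)))
    (C : Type (v + 1)) [Category.{v} C] (hC : LocallyPresentable C)
    (A : C → Prop)
    (hprod : ∀ (σ : Type v) (b : σ → C) (c : Fan b), IsLimit c →
      (∀ s, A (b s)) → A c.pt)
    (X : C) :
    ∃ (σ : Type v) (g : σ → Under X),
      (∀ s, A ((g s).right)) ∧
      ∀ Y : Under X, A Y.right → ∃ s, Nonempty (g s ⟶ Y) := by
  have hC' := (locallyPresentable_iff C).1 hC
  have hU := (locallyPresentable_iff (Under X)).2 (under_isLocallyPresentable C X)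
  have hL := hasLimits_of_isLocallyPresentable C
  by_contra hcon
  push Not at hcon
  have step : ∀ (a : Ordinal.{v}) (g : ∀ b : Ordinal.{v}, b < a → {Y : Under X // A Y.right}),
      ∃ Z : {Y : Under X // A Y.right}, (∀ b hb, Nonempty (Z.1 ⟶ (g b hb).1)) ∧
        (∀ b hb, IsEmpty ((g b hb).1 ⟶ Z.1)) := by
    intro a g
    let σ := Shrink.{v} (Set.Iio a)
    let e : σ ≃ Set.Iio a := (equivShrink _).symm
    let g' : σ → {Y : Under X // A Y.right} := fun s => g (e s).1 (e s).2
    obtain ⟨Y, hY, hY'⟩ := hcon σ (fun s => (g' s).1) (fun s => (g' s).2)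
    let q : Option σ → {Y : Under X // A Y.right} := fun o => o.elim ⟨Y, hY⟩ g'
    let b : Option σ → C := fun o => (q o).1.right
    let Z : Under X := Under.mk (Pi.lift (fun o => (q o).1.hom) : X ⟶ ∏ᶜ b)
    have hZ : A Z.right := hprod _ b _ (productIsProduct b) (fun o => (q o).2)
    let π : ∀ o, Z ⟶ (q o).1 := fun o => Under.homMk (Pi.π b o) (by simp [Z, b])
    refine ⟨⟨Z, hZ⟩, ?_, ?_⟩
    · intro c hc
      have h := π (some (e.symm ⟨c, hc⟩))
      have hq : q (some (e.symm ⟨c, hc⟩)) = g c hc := by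
        simp [q, g']
      rw [hq] at h
      exact ⟨h⟩
    · intro c hc
      refine ⟨fun k => ?_⟩
      have hq : g' (e.symm ⟨c, hc⟩) = g c hc := by
        simp [g']
      have h := hY' (e.symm ⟨c, hc⟩)
      rw [hq] at h
      exact h.false (k ≫ π none)
  choose F hF₁ hF₂ using step
  let f : Ordinal.{v} → {Y : Under X // A Y.right} :=
    (wellFounded_lt : WellFounded ((· < ·) : Ordinal.{v} → Ordinal.{v} → Prop)).fix F
  have hf : ∀ a, f a = F a (fun b _ => f b) := fun a => WellFounded.fix_eq _ _ _
  refine wvp (Under X) hU ⟨fun a => (f a).1, ?_, ?_⟩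
  · intro a b hab
    have := hF₂ b (fun c _ => f c) a hab
    rwa [← hf b] at this
  · intro a b hba
    rcases hba.eq_or_lt with rfl | hlt
    · exact ⟨𝟙 _⟩
    · have := hF₁ a (fun c _ => f c) b hlt
      rwa [← hf a] at this
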